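/- A valued field (K,v) is separable-algebraically maximal if and only if (K,v) is O-extremal with respect to every separable polynomial in one variable with coefficients in K. -/

import Mathlib

open scoped Classical

noncomputable section

namespace ValuedDefect

universe u v

variable {K : Type u} {L : Type v} [Field K] [Field L]

/-- The ramification index `(vL : vK)`: the index of the image of `Kˣ` in the
value group `Lˣ / Bˣ` of the valuation subring `B` of `L`. -/
def ramIndex (K : Type u) {L : Type v} [Field K] [Field L] [Algebra K L]
    (B : ValuationSubring L) : ℕ :=
  (Subgroup.map (QuotientGroup.mk' B.unitGroup)
    (MonoidHom.range (Units.map (algebraMap K L).toMonoidHom))).index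

/-- The ring homomorphism `A →+* B` induced by `algebraMap K L` when `B` lies above `A`. -/
def valHom [Algebra K L] (A : ValuationSubring K) (B : ValuationSubring L)
    (h : B.comap (algebraMap K L) = A) : A →+* B where
  toFun x := ⟨algebraMap K L x, by
    have hx : (x : K) ∈ B.comap (algebraMap K L) := by rw [h]; exact x.2
    exact ValuationSubring.mem_comap.mp hx⟩
  map_one' := Subtype.ext (by simp)
  map_mul' x y := Subtype.ext (by simp)
  map_zero' := Subtype.ext (by simp)
  map_add' x y := Subtype.ext (by simp)

theorem valHom_isLocalHom [Algebra K L] (A : ValuationSubring K) (B : ValuationSubring L)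
    (h : B.comap (algebraMap K L) = A) : IsLocalHom (valHom A B h) := by
  constructor
  intro x hx
  rcases isUnit_iff_exists_inv.mp hx with ⟨y, hy⟩
  have hy' : algebraMap K L (x : K) * (y : L) = 1 := congrArg Subtype.val hy
  have hx0 : (x : K) ≠ 0 := by
    rintro h0
    rw [h0, map_zero, zero_mul] at hy'
    exact zero_ne_one hy'
  have hyx : (y : L) = algebraMap K L ((x : K)⁻¹) := by
    rw [map_inv₀]
    exact eq_inv_of_mul_eq_one_right hy'
  have hmem : ((x : K)⁻¹ : K) ∈ A := by
    have hB : algebraMap K L ((x : K)⁻¹) ∈ B := hyx ▸ y.2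
    have := ValuationSubring.mem_comap.mpr hB
    rwa [h] at this
  refine isUnit_iff_exists_inv.mpr ⟨⟨(x : K)⁻¹, hmem⟩, Subtype.ext ?_⟩
  exact mul_inv_cancel₀ hx0

/-- The residue degree `[Lv : Kv]` of an extension of valuation subrings. -/
def residueDegree [Algebra K L] (A : ValuationSubring K) (B : ValuationSubring L) : ℕ :=
  if h : B.comap (algebraMap K L) = A then
    letI := valHom_isLocalHom A B h
    letI := (IsLocalRing.ResidueField.map (valHom A B h)).toAlgebra
    Module.finrank (IsLocalRing.ResidueField A) (IsLocalRing.ResidueField B)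
  else 0

/-- A finite extension of valued fields (with unique extension of the valuation) is
defectless if `[L : K] = (vL : vK) · [Lv : Kv]`. -/
def IsDefectless [Algebra K L] (A : ValuationSubring K) (B : ValuationSubring L) : Prop :=
  Module.finrank K L = ramIndex K B * residueDegree A B

/-- An extension of valued fields is immediate if `vL = vK` and `Lv = Kv`. -/
def IsImmediate (K : Type u) {L : Type v} [Field K] [Field L] [Algebra K L]
    (B : ValuationSubring L) : Prop :=
  (∀ x : L, x ≠ 0 → ∃ c : K, B.valuation x = B.valuation (algebraMap K L c)) ∧
  ∀ x : L, B.valuation x ≤ 1 → ∃ c : K, B.valuation (x - algebraMap K L c) < 1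

/-- A valued field is a defectless field if every finite extension is defectless. -/
def IsDefectlessField {K : Type u} [Field K] (A : ValuationSubring K) : Prop :=
  ∀ (L : Type u) [Field L] [Algebra K L], FiniteDimensional K L →
    ∀ B : ValuationSubring L, B.comap (algebraMap K L) = A → IsDefectless A B

/-- A valued field is a separably defectless field if every finite separable extension is
defectless. -/
def IsSepDefectlessField {K : Type u} [Field K] (A : ValuationSubring K) : Prop :=
  ∀ (L : Type u) [Field L] [Algebra K L], FiniteDimensional K L → Algebra.IsSeparable K L →
    ∀ B : ValuationSubring L, B.comap (algebraMap K L) = A → IsDefectless A B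

/-- A valued field is inseparably defectless if every finite purely inseparable extension is
defectless. -/
def IsInsepDefectless {K : Type u} [Field K] (A : ValuationSubring K) : Prop :=
  ∀ (L : Type u) [Field L] [Algebra K L], FiniteDimensional K L → IsPurelyInseparable K L →
    ∀ B : ValuationSubring L, B.comap (algebraMap K L) = A → IsDefectless A B

/-- A valued field is algebraically maximal if it admits no proper immediate algebraic
extension. -/
def IsAlgMaximal {K : Type u} [Field K] (A : ValuationSubring K) : Prop :=
  ∀ (L : Type u) [Field L] [Algebra K L], Algebra.IsAlgebraic K L →
    ∀ B : ValuationSubring L, B.comap (algebraMap K L) = A → IsImmediate K B →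
      Function.Surjective (algebraMap K L)

/-- A valued field is separable-algebraically maximal if it admits no proper immediate
separable-algebraic extension. -/
def IsSepAlgMaximal {K : Type u} [Field K] (A : ValuationSubring K) : Prop :=
  ∀ (L : Type u) [Field L] [Algebra K L], Algebra.IsAlgebraic K L → Algebra.IsSeparable K L →
    ∀ B : ValuationSubring L, B.comap (algebraMap K L) = A → IsImmediate K B →
      Function.Surjective (algebraMap K L)

/-- `(K,v)` is `K`-extremal with respect to `f` if the set `{v f(a) : a ∈ K}` has a maximum
(in the multiplicative convention: a minimum). -/
def KExtremal (A : ValuationSubring K) (f : Polynomial K) : Prop :=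
  ∃ a : K, ∀ b : K, A.valuation (f.eval a) ≤ A.valuation (f.eval b)

/-- `(K,v)` is `O`-extremal with respect to `f` if the set `{v f(a) : a ∈ O}` has a maximum. -/
def OExtremal (A : ValuationSubring K) (f : Polynomial K) : Prop :=
  ∃ a : A, ∀ b : A, A.valuation (f.eval (a : K)) ≤ A.valuation (f.eval (b : K))

/-- `K`-extremality for multivariable polynomials. -/
def KExtremalMv (A : ValuationSubring K) {n : ℕ} (f : MvPolynomial (Fin n) K) : Prop :=
  ∃ a : Fin n → K, ∀ b : Fin n → K,
    A.valuation (MvPolynomial.eval a f) ≤ A.valuation (MvPolynomial.eval b f)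

/-- A `p`-polynomial: an additive polynomial plus a constant. -/
def IsPPolynomial (p : ℕ) (f : Polynomial K) : Prop :=
  ∃ (c : K) (m : ℕ) (co : ℕ → K),
    f = Polynomial.C c + ∑ i ∈ Finset.range (m + 1), Polynomial.C (co i) * Polynomial.X ^ p ^ i

/-- A field of characteristic `p > 0` is Artin-Schreier closed if every polynomial
`X^p - X - a` has a root. -/
def ASClosed (K : Type*) [Field K] (p : ℕ) : Prop :=
  ∀ a : K, ∃ x : K, x ^ p - x = a

/-- The subfield `K^p` of `p`-th powers of a field of characteristic `p`. -/
def pPowerSubfield (K : Type*) [Field K] (p : ℕ) (hp : p.Prime) [CharP K p] : Subfield K :=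
  haveI : Fact p.Prime := ⟨hp⟩
  (frobenius K p).fieldRange

/-- The field `K^{1/p}` of `p`-th roots of `K` inside a purely inseparable extension `P`. -/
def pthRootField (K : Type u) (P : Type v) [Field K] [Field P] [Algebra K P]
    (p : ℕ) (hp : p.Prime) [CharP K p] : IntermediateField K P :=
  haveI : Fact p.Prime := ⟨hp⟩
  haveI : CharP P p := charP_of_injective_algebraMap (algebraMap K P).injective p
  { carrier := {x : P | x ^ p ∈ (algebraMap K P).range}
    mul_mem' := fun {a b} ha hb => by
      rcases ha with ⟨c, hc⟩
      rcases hb with ⟨d, hd⟩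
      exact ⟨c * d, by rw [map_mul, hc, hd, mul_pow]⟩
    one_mem' := ⟨1, by rw [map_one, one_pow]⟩
    add_mem' := fun {a b} ha hb => by
      rcases ha with ⟨c, hc⟩
      rcases hb with ⟨d, hd⟩
      exact ⟨c + d, by rw [map_add, hc, hd, add_pow_char]⟩
    zero_mem' := ⟨0, by rw [map_zero, zero_pow hp.ne_zero]⟩
    algebraMap_mem' := fun r => ⟨r ^ p, by rw [map_pow]⟩
    inv_mem' := fun x hx => by
      rcases hx with ⟨c, hc⟩
      exact ⟨c⁻¹, by rw [map_inv₀, hc, inv_pow]⟩ }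

/-- A (possibly infinite) algebraic extension of valued fields is defectless if every finite
subextension is defectless. -/
def IsDefectlessAlgExt {K : Type u} {L : Type v} [Field K] [Field L] [Algebra K L]
    (A : ValuationSubring K) (B : ValuationSubring L) : Prop :=
  ∀ E : IntermediateField K L, FiniteDimensional K E →
    IsDefectless A (B.comap (algebraMap E L))

section Multiset

variable {Γ : Type*} [LinearOrderedCommGroupWithZero Γ]

theorem multiset_prod_map_lt {ι : Type*} {s : Multiset ι} {f g : ι → Γ}
    (hle : ∀ i ∈ s, f i ≤ g i) (hg : ∀ i ∈ s, g i ≠ 0) {i : ι} (hi : i ∈ s) (hlt : f i < g i) :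
    (s.map f).prod < (s.map g).prod := by
  obtain ⟨t, rfl⟩ := Multiset.exists_cons_of_mem hi
  simp only [Multiset.map_cons, Multiset.prod_cons]
  have hle' : (t.map f).prod ≤ (t.map g).prod :=
    Multiset.prod_map_le_prod_map₀ f g (fun _ _ => zero_le)
      fun j hj => hle j (Multiset.mem_cons_of_mem hj)
  have hpos : 0 < (t.map g).prod := by
    rw [zero_lt_iff]
    refine Multiset.prod_ne_zero fun h => ?_
    obtain ⟨j, hj, hj0⟩ := Multiset.mem_map.mp h
    exact hg j (Multiset.mem_cons_of_mem hj) hj0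
  calc f i * (t.map f).prod ≤ f i * (t.map g).prod := mul_le_mul_right hle' _
    _ < g i * (t.map g).prod := mul_lt_mul_of_pos_right hlt hpos

/-- A family of values without lower obstruction at each of finitely many bounds passes below all
of these bounds simultaneously. -/
theorem exists_forall_lt_of_multiset {ι α : Type*} [Nonempty α] (s : Multiset ι) (f : α → Γ)
    (g : ι → Γ) (h : ∀ i ∈ s, ∃ a, f a < g i) : ∃ a, ∀ i ∈ s, f a < g i := by
  induction s using Multiset.induction with
  | empty => exact ⟨Classical.arbitrary α, by simp⟩
  | cons i s ih =>
    obtain ⟨a, ha⟩ := ih fun j hj => h j (Multiset.mem_cons_of_mem hj)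
    obtain ⟨b, hb⟩ := h i (Multiset.mem_cons_self i s)
    rcases le_total (f a) (f b) with hab | hab
    · exact ⟨a, fun j hj => (Multiset.mem_cons.mp hj).elim
        (fun e => e ▸ hab.trans_lt hb) (ha j)⟩
    · exact ⟨b, fun j hj => (Multiset.mem_cons.mp hj).elim
        (fun e => e ▸ hb) (fun hj => hab.trans_lt (ha j hj))⟩

end Multiset

section Valuation

open Polynomial

variable {M : Type*} [Field M] {Γ : Type*} [LinearOrderedCommGroupWithZero Γ] (w : Valuation M Γ)

theorem valuation_eval_eq {f : M[X]} (hf : f.Splits) (x : M) :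
    w (f.eval x) = w f.leadingCoeff * (f.roots.map fun r => w (x - r)).prod := by
  rw [hf.eval_eq_prod_roots, map_mul, map_multiset_prod, Multiset.map_map]
  rfl

/-- If each root of a split polynomial has a best approximation in `T`, then the value of the
polynomial on `T` attains its minimum. -/
theorem exists_min_valuation_eval {f : M[X]} (hf : f.Splits) {T : Set M} (hT : T.Nonempty)
    (h : ∀ y ∈ f.roots, ∃ a ∈ T, ∀ b ∈ T, w (a - y) ≤ w (b - y)) :
    ∃ a ∈ T, ∀ b ∈ T, w (f.eval a) ≤ w (f.eval b) := by
  by_cases h0 : f.roots = 0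
  · obtain ⟨a, ha⟩ := hT
    exact ⟨a, ha, fun b _ => by simp [valuation_eval_eq w hf, h0]⟩
  have hne : f.roots.toFinset.Nonempty := by simpa [Finset.nonempty_iff_ne_empty] using h0
  choose! α hα hmin using h
  obtain ⟨i, hi, hi'⟩ := f.roots.toFinset.exists_min_image (fun y => w (f.eval (α y))) hne
  refine ⟨α i, hα i (Multiset.mem_toFinset.mp hi), fun b hb => ?_⟩
  obtain ⟨j, hj, hj'⟩ := f.roots.toFinset.exists_min_image (fun y => w (b - y)) hne
  refine (hi' j hj).trans ?_
  rw [valuation_eval_eq w hf, valuation_eval_eq w hf]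
  refine mul_le_mul_right (Multiset.prod_map_le_prod_map₀ _ _ (fun _ _ => zero_le)
    fun k hk => ?_) _
  have h1 : w (b - j) ≤ w (b - k) := hj' k (Multiset.mem_toFinset.mpr hk)
  have h2 : w (α j - j) ≤ w (b - k) := (hmin j (Multiset.mem_toFinset.mp hj) b hb).trans h1
  have h3 : α j - k = (α j - j) - (b - j) + (b - k) := by ring
  rw [h3]
  exact w.map_add_le (w.map_sub_le h2 h1) le_rfl

/-- If `a` is closer to `x` than every root of `f`, then `f a` and `f x` have the same leading
term. -/
theorem valuation_eval_sub_eval_lt {f : M[X]} (hf : f.Splits) (hf0 : f ≠ 0) {a x : M}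
    (h : ∀ r ∈ f.roots, w (a - x) < w (r - x)) :
    w (f.eval a - f.eval x) < w (f.eval x) := by
  rw [hf.eval_eq_prod_roots, hf.eval_eq_prod_roots, ← mul_sub, map_mul, map_mul]
  refine mul_lt_mul_of_pos_left ?_ (by simpa [zero_lt_iff] using hf0)
  revert h
  generalize f.roots = s
  intro h
  induction s using Multiset.induction with
  | empty => simp
  | cons r s ih =>
    have ih := ih fun j hj => h j (Multiset.mem_cons_of_mem hj)
    have hr := h r (Multiset.mem_cons_self r s)
    rw [w.map_sub_swap r x] at hr
    have hr' : w (a - r) = w (x - r) := by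
      have : a - r = (a - x) + (x - r) := by ring
      rw [this]; exact w.map_add_eq_of_lt_right hr
    simp only [Multiset.map_cons, Multiset.prod_cons]
    set P := (s.map fun r => a - r).prod
    set Q := (s.map fun r => x - r).prod
    have e : (a - r) * P - (x - r) * Q = (a - r) * (P - Q) + (a - x) * Q := by ring
    rw [e, map_mul w (x - r)]
    refine w.map_add_lt ?_ ?_
    · rw [map_mul, hr']
      exact mul_lt_mul_of_pos_left ih (zero_le.trans_lt hr)
    · rw [map_mul]
      exact mul_lt_mul_of_pos_right hr (zero_le.trans_lt ih)

/-- The nonzero values of an algebraic extension are bounded below by nonzero values of the base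
field. -/
theorem exists_ne_zero_valuation_le {K : Type*} [Field K] [Algebra K M] {r : M}
    (hr : IsAlgebraic K r) (hr0 : r ≠ 0) :
    ∃ d : K, d ≠ 0 ∧ w (algebraMap K M d) ≤ w r := by
  rcases le_total 1 (w r) with h1 | h1
  · exact ⟨1, one_ne_zero, by simpa using h1⟩
  set p := minpoly K r
  have hp0 : p.coeff 0 ≠ 0 := minpoly.coeff_zero_ne_zero hr.isIntegral hr0
  have hp : aeval r p.divX * r + algebraMap K M (p.coeff 0) = 0 := by
    have := congrArg (aeval r) (divX_mul_X_add p)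
    simpa [p, minpoly.aeval] using this
  obtain ⟨i, -, hi⟩ := (Finset.range (p.divX.natDegree + 1)).exists_max_image
    (fun i => w (algebraMap K M (p.divX.coeff i))) ⟨0, by simp⟩
  have hle : w (aeval r p.divX) ≤ w (algebraMap K M (p.divX.coeff i)) := by
    rw [aeval_eq_sum_range]
    refine w.map_sum_le fun j hj => ?_
    rw [Algebra.smul_def, map_mul, map_pow]
    exact (mul_le_of_le_one_right' (pow_le_one' h1 j)).trans (hi j hj)
  have hc : w (algebraMap K M (p.coeff 0)) ≤ w (algebraMap K M (p.divX.coeff i)) * w r := by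
    rw [eq_neg_of_add_eq_zero_right hp, Valuation.map_neg, map_mul]
    exact mul_le_mul_left hle _
  have hi0 : p.divX.coeff i ≠ 0 := by
    intro h
    rw [h, map_zero, map_zero, zero_mul, le_zero_iff, w.zero_iff] at hc
    exact hp0 ((map_eq_zero _).mp hc)
  refine ⟨p.coeff 0 / p.divX.coeff i, div_ne_zero hp0 hi0, ?_⟩
  rw [map_div₀, map_div₀]
  exact div_le_of_le_mul₀ zero_le zero_le (by rwa [mul_comm])

end Valuation

section Extension

variable {K : Type*} {L : Type*} [Field K] [Field L]

theorem comap_valuation_le_iff (f : K →+* L) (B : ValuationSubring L) (x y : K) :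
    (B.comap f).valuation x ≤ (B.comap f).valuation y ↔ B.valuation (f x) ≤ B.valuation (f y) := by
  by_cases hy : y = 0
  · simp [hy]
  have hy' : f y ≠ 0 := (map_ne_zero f).mpr hy
  have h1 : 0 < (B.comap f).valuation y := by simpa [zero_lt_iff] using hy
  have h2 : 0 < B.valuation (f y) := by simpa [zero_lt_iff] using hy
  rw [← div_le_one₀ h1, ← div_le_one₀ h2, ← map_div₀, ← map_div₀, ← map_div₀,
    ValuationSubring.valuation_le_one_iff, ValuationSubring.valuation_le_one_iff,
    ValuationSubring.mem_comap]

theorem exists_valuationSubring_comap_eq (f : K →+* L) (A : ValuationSubring K) :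
    ∃ B : ValuationSubring L, B.comap f = A := by
  obtain ⟨B, hle, hloc⟩ := (A.toLocalSubring.map f).exists_le_valuationSubring
  refine ⟨B, ?_⟩
  ext x
  rw [ValuationSubring.mem_comap]
  refine ⟨fun hx => ?_, fun hx => hle ⟨x, hx, rfl⟩⟩
  by_contra hxA
  have hx0 : x ≠ 0 := by rintro rfl; exact hxA A.zero_mem
  have hinv : x⁻¹ ∈ A := (A.mem_or_inv_mem x).resolve_left hxA
  have hmem : f x⁻¹ ∈ (A.toLocalSubring.map f).toSubring := ⟨x⁻¹, hinv, rfl⟩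
  have hu : IsUnit (Subring.inclusion hle ⟨f x⁻¹, hmem⟩) :=
    isUnit_iff_exists_inv.mpr ⟨⟨f x, hx⟩, Subtype.ext (by
      change f x⁻¹ * f x = 1
      rw [← map_mul, inv_mul_cancel₀ hx0, map_one])⟩
  obtain ⟨⟨_, a, ha, rfl⟩, hb⟩ := isUnit_iff_exists_inv.mp (hloc.map_nonunit _ hu)
  have hb' : f (x⁻¹ * a) = f 1 := by
    rw [map_mul, map_one]; exact congrArg Subtype.val hb
  have hxa : a = x := by
    have := f.injective hb'
    rwa [inv_mul_eq_one₀ hx0, eq_comm] at this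
  exact hxA (hxa ▸ ha)

end Extension

section Immediate

variable {K : Type*} {L : Type*} [Field K] [Field L] [Algebra K L]

theorem isImmediate_of_forall_exists_valuation_sub_lt {B : ValuationSubring L}
    (h : ∀ x : L, x ≠ 0 → ∃ c : K, B.valuation (x - algebraMap K L c) < B.valuation x) :
    IsImmediate K B := by
  refine ⟨fun x hx => ?_, fun x hx => ?_⟩
  · obtain ⟨c, hc⟩ := h x hx
    refine ⟨c, ?_⟩
    have := B.valuation.map_sub_eq_of_lt_left hc
    rwa [sub_sub_cancel, eq_comm] at this
  · by_cases hx0 : x = 0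
    · exact ⟨0, by simp [hx0]⟩
    · obtain ⟨c, hc⟩ := h x hx0
      exact ⟨c, hc.trans_le hx⟩

theorem IsImmediate.exists_valuation_sub_lt {B : ValuationSubring L} (h : IsImmediate K B) {x : L}
    (hx : x ≠ 0) : ∃ c : K, B.valuation (x - algebraMap K L c) < B.valuation x := by
  obtain ⟨c, hc⟩ := h.1 x hx
  have hx' : B.valuation x ≠ 0 := by simpa using hx
  have hc0 : algebraMap K L c ≠ 0 := by
    intro h0
    rw [h0, map_zero] at hc
    exact hx' hc
  obtain ⟨d, hd⟩ := h.2 (x / algebraMap K L c) (by rw [map_div₀, ← hc, div_self hx'])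
  refine ⟨c * d, ?_⟩
  have e : x - algebraMap K L (c * d) =
      algebraMap K L c * (x / algebraMap K L c - algebraMap K L d) := by
    rw [map_mul]; field_simp
  rw [e, map_mul, ← hc]
  exact mul_lt_of_lt_one_right (zero_lt_iff.mpr hx') hd

theorem IsImmediate.exists_valuation_sub_lt_sub {B : ValuationSubring L} (h : IsImmediate K B)
    {x : L} (hx : x ∉ (algebraMap K L).range) (a : K) :
    ∃ b : K, B.valuation (algebraMap K L b - x) < B.valuation (algebraMap K L a - x) := by
  obtain ⟨c, hc⟩ := h.exists_valuation_sub_lt (x := x - algebraMap K L a)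
    fun h0 => hx ⟨a, (sub_eq_zero.mp h0).symm⟩
  refine ⟨a + c, ?_⟩
  rwa [B.valuation.map_sub_swap, B.valuation.map_sub_swap (algebraMap K L a), map_add, ← sub_sub]

end Immediate

section Approximation

open Polynomial

variable {K : Type u} {M : Type*} [Field K] [Field M] [Algebra K M]
variable {Γ : Type*} [LinearOrderedCommGroupWithZero Γ] (w : Valuation M Γ)

/-- On a small ball around an element without best approximation in `K`, improving the
approximation does not increase the distance to any of finitely many given elements. -/
theorem exists_forall_valuation_sub_le {x : M}
    (hx : ∀ a : K, ∃ b : K, w (algebraMap K M b - x) < w (algebraMap K M a - x))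
    (s : Multiset M) :
    ∃ a₀ : K, ∀ b b' : K, w (algebraMap K M b - x) ≤ w (algebraMap K M a₀ - x) →
      w (algebraMap K M b' - x) < w (algebraMap K M b - x) → ∀ y ∈ s,
        w (algebraMap K M b' - y) ≤ w (algebraMap K M b - y) ∧ w (algebraMap K M b - y) ≠ 0 := by
  obtain ⟨a₀, ha₀⟩ := exists_forall_lt_of_multiset
    (s.filter fun y => ∃ a : K, w (algebraMap K M a - x) < w (x - y))
    (fun a : K => w (algebraMap K M a - x)) (fun y => w (x - y))
    (fun y hy => (Multiset.mem_filter.mp hy).2)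
  refine ⟨a₀, fun b b' hb hb' y hy => ?_⟩
  have eb : algebraMap K M b - y = (algebraMap K M b - x) + (x - y) := by ring
  have eb' : algebraMap K M b' - y = (algebraMap K M b' - x) + (x - y) := by ring
  by_cases h : ∃ a : K, w (algebraMap K M a - x) < w (x - y)
  · have h0 := ha₀ y (Multiset.mem_filter.mpr ⟨hy, h⟩)
    have h1 := hb.trans_lt h0
    rw [eb, eb', w.map_add_eq_of_lt_right h1, w.map_add_eq_of_lt_right (hb'.trans h1)]
    exact ⟨le_rfl, (zero_le.trans_lt h1).ne'⟩
  · push Not at h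
    obtain ⟨c, hc⟩ := hx b
    have h1 : w (x - y) < w (algebraMap K M b - x) := (h c).trans_lt hc
    rw [eb, eb', w.map_add_eq_of_lt_left h1]
    exact ⟨w.map_add_le hb'.le h1.le, (zero_le.trans_lt h1).ne'⟩

variable [IsAlgClosed M] [Algebra.IsAlgebraic K M]

/-- Among the elements having the same approximations in `K` as a given separable element without
best approximation, one of minimal degree can be chosen separable. -/
theorem exists_isSeparable_minimal {y : M} (hy : IsSeparable K y)
    (hlt : ∀ a : K, ∃ b : K, w (algebraMap K M b - y) < w (algebraMap K M a - y)) :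
    ∃ z : M, IsSeparable K z ∧ (∀ a : K, w (z - y) ≤ w (algebraMap K M a - y)) ∧
      ∀ r : M, (∀ a : K, w (r - y) ≤ w (algebraMap K M a - y)) →
        (minpoly K z).natDegree ≤ (minpoly K r).natDegree := by
  obtain ⟨z, hz, hmin⟩ := (measure fun r : M => (minpoly K r).natDegree).wf.has_min
    {r : M | ∀ a : K, w (r - y) ≤ w (algebraMap K M a - y)} ⟨y, fun a => by simp⟩
  replace hmin : ∀ r : M, (∀ a : K, w (r - y) ≤ w (algebraMap K M a - y)) →
      (minpoly K z).natDegree ≤ (minpoly K r).natDegree := fun r hr => not_lt.mp (hmin r hr)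
  by_cases hsep : IsSeparable K z
  · exact ⟨z, hsep, hz, hmin⟩
  have hzi : IsIntegral K z := (Algebra.IsAlgebraic.isAlgebraic z).isIntegral
  set q := minpoly K z
  have hq : q.Monic := minpoly.monic hzi
  have hder : derivative q = 0 := by
    by_contra h
    exact hsep ((separable_iff_derivative_ne_zero (minpoly.irreducible hzi)).mpr h)
  have hdeg : 1 < q.natDegree := by
    have h0 : 0 < q.natDegree := minpoly.natDegree_pos hzi
    by_contra h
    have h1 : q.natDegree = 1 := by omega
    have h2 : (derivative q).coeff 0 = 1 := by
      rw [coeff_derivative]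
      have : q.coeff (0 + 1) = 1 := by rw [zero_add, ← h1]; exact hq
      simp [this]
    rw [hder] at h2
    simp at h2
  have hzy : z - y ≠ 0 := fun h => hsep (sub_eq_zero.mp h ▸ hy)
  obtain ⟨d, hd0, hd⟩ := exists_ne_zero_valuation_le w
    (Algebra.IsAlgebraic.isAlgebraic (R := K) (z - y)) hzy
  have hz0 : z ≠ 0 := by
    rintro rfl
    obtain ⟨b, hb⟩ := hlt 0
    exact absurd (hz b) (not_le.mpr (by simpa using hb))
  obtain ⟨e, he0, he⟩ := exists_ne_zero_valuation_le w
    (Algebra.IsAlgebraic.isAlgebraic (R := K) z⁻¹) (inv_ne_zero hz0)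
  have hc0 : d ^ q.natDegree * e ≠ 0 := mul_ne_zero (pow_ne_zero _ hd0) he0
  set c := d ^ q.natDegree * e
  have hclt : (C c * X).degree < q.degree := by
    rw [degree_C_mul_X hc0, degree_eq_natDegree hq.ne_zero]
    exact_mod_cast hdeg
  have hmonic : (q + C c * X).Monic := hq.add_of_left hclt
  have hnat : (q + C c * X).natDegree = q.natDegree :=
    natDegree_add_eq_left_of_degree_lt hclt
  have hsep' : (q + C c * X).Separable := by
    rw [separable_def]
    have : derivative (q + C c * X) = C c := by simp [hder]
    rw [this]
    exact ⟨0, C c⁻¹, by rw [zero_mul, zero_add, ← C_mul, inv_mul_cancel₀ hc0, C_1]⟩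
  set g := (q + C c * X).map (algebraMap K M)
  have hg : g.Splits := IsAlgClosed.splits g
  have hgm : g.Monic := hmonic.map _
  have hgz : g.eval z = algebraMap K M c * z := by
    have : aeval z q = 0 := minpoly.aeval K z
    rw [eval_map_algebraMap]
    simp [this]
  have hcard : g.roots.card = q.natDegree := by
    rw [← hg.natDegree_eq_card_roots, natDegree_map, hnat]
  have hval : w (g.eval z) ≤ w (algebraMap K M d) ^ q.natDegree := by
    have : w (algebraMap K M e) * w z ≤ 1 := by
      have h0 : 0 < w z := by simpa [zero_lt_iff] using hz0
      rw [map_inv₀] at he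
      calc _ ≤ (w z)⁻¹ * w z := mul_le_mul_left he _
        _ = 1 := inv_mul_cancel₀ h0.ne'
    rw [hgz, map_mul, map_mul, map_mul, map_pow, map_pow, mul_assoc]
    exact mul_le_of_le_one_right' this
  have hroot : ∃ r ∈ g.roots, w (z - r) ≤ w (algebraMap K M d) := by
    by_contra! h
    obtain ⟨r, hr⟩ := Multiset.card_pos_iff_exists_mem.mp (by omega : 0 < g.roots.card)
    have := multiset_prod_map_lt (f := fun _ => w (algebraMap K M d)) (fun i hi => (h i hi).le)
      (fun i hi => (zero_le.trans_lt (h i hi)).ne') hr (h r hr)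
    rw [Multiset.map_const', Multiset.prod_replicate, hcard] at this
    rw [valuation_eval_eq w hg, hgm.leadingCoeff, map_one, one_mul] at hval
    exact absurd hval (not_le.mpr this)
  obtain ⟨r, hr, hrz⟩ := hroot
  have hdvd : minpoly K r ∣ q + C c * X := by
    refine minpoly.dvd K r ?_
    rw [← eval_map_algebraMap]
    exact (mem_roots'.mp hr).2
  refine ⟨r, hsep'.of_dvd hdvd, fun a => ?_, fun t ht => ?_⟩
  · have e : r - y = (z - y) - (z - r) := by ring
    rw [e]
    exact w.map_sub_le (hz a) ((hrz.trans hd).trans (hz a))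
  · exact ((natDegree_le_of_dvd hdvd hmonic.ne_zero).trans hnat.le).trans (hmin t ht)

/-- An element of minimal degree among those with the same approximations in `K` as `y` generates
an extension in which every nonzero element has the leading term of an element of `K`. -/
theorem exists_valuation_sub_lt_of_minimal {y z : M}
    (hz : ∀ a : K, w (z - y) ≤ w (algebraMap K M a - y))
    (hmin : ∀ r : M, (∀ a : K, w (r - y) ≤ w (algebraMap K M a - y)) →
      (minpoly K z).natDegree ≤ (minpoly K r).natDegree)
    {x : M} (hx : x ∈ IntermediateField.adjoin K {z}) (hx0 : x ≠ 0) :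
    ∃ c : K, w (x - algebraMap K M c) < w x := by
  have hzi : IsIntegral K z := (Algebra.IsAlgebraic.isAlgebraic z).isIntegral
  obtain ⟨p, hp, hpx⟩ : ∃ p : K[X], p.natDegree < (minpoly K z).natDegree ∧ aeval z p = x := by
    obtain ⟨p, hp, hpx⟩ := (IntermediateField.adjoin.powerBasis hzi).exists_eq_aeval ⟨x, hx⟩
    refine ⟨p, by simpa using hp, ?_⟩
    have := congrArg (IntermediateField.val _) hpx
    rw [← Polynomial.aeval_algHom_apply] at this
    simpa using this.symm
  have hp0 : p ≠ 0 := by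
    rintro rfl
    exact hx0 (by simpa using hpx.symm)
  set g := p.map (algebraMap K M)
  have hg : g.Splits := IsAlgClosed.splits g
  have hg0 : g ≠ 0 := (Polynomial.map_ne_zero_iff (algebraMap K M).injective).mpr hp0
  have hroots : ∀ r ∈ g.roots, ∃ a : K, w (algebraMap K M a - z) < w (r - z) := by
    intro r hr
    have hr' : ∃ a : K, w (algebraMap K M a - y) < w (r - y) := by
      by_contra! h
      have h1 := hmin r h
      have h2 : minpoly K r ∣ p := by
        refine minpoly.dvd K r ?_
        rw [← eval_map_algebraMap]
        exact (mem_roots'.mp hr).2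
      exact absurd ((h1.trans (natDegree_le_of_dvd h2 hp0)).trans_lt hp) (lt_irrefl _)
    obtain ⟨a, ha⟩ := hr'
    refine ⟨a, ?_⟩
    have e1 : algebraMap K M a - z = (algebraMap K M a - y) - (z - y) := by ring
    have e2 : r - z = (r - y) - (z - y) := by ring
    rw [e2, w.map_sub_eq_of_lt_left ((hz a).trans_lt ha), e1]
    exact (w.map_sub_le le_rfl (hz a)).trans_lt ha
  obtain ⟨a, ha⟩ := exists_forall_lt_of_multiset g.roots
    (fun a : K => w (algebraMap K M a - z)) (fun r => w (r - z)) hroots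
  refine ⟨p.eval a, ?_⟩
  have := valuation_eval_sub_eval_lt w hg hg0 ha
  rwa [w.map_sub_swap, eval_map_algebraMap, eval_map_algebraMap, aeval_algebraMap_apply, hpx,
    coe_aeval_eq_eval] at this

end Approximation

open Polynomial

theorem IsSepAlgMaximal.oExtremal {K : Type u} [Field K] {A : ValuationSubring K}
    (hA : IsSepAlgMaximal A) {f : K[X]} (hf : f.Separable) : OExtremal A f := by
  let M := AlgebraicClosure K
  obtain ⟨B, hB⟩ := exists_valuationSubring_comap_eq (algebraMap K M) A
  set w := B.valuation
  have hle : ∀ x y : K, A.valuation x ≤ A.valuation y ↔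
      w (algebraMap K M x) ≤ w (algebraMap K M y) := by
    intro x y
    rw [← hB]
    exact comap_valuation_le_iff _ B x y
  have hone : ∀ x : K, w (algebraMap K M x) ≤ 1 ↔ x ∈ A := by
    intro x
    rw [← A.valuation_le_one_iff]
    simpa using (hle x 1).symm
  by_contra hext
  set g := f.map (algebraMap K M)
  have hy : ∃ y ∈ g.roots, ∀ a : K, a ∈ A →
      ∃ b ∈ A, w (algebraMap K M b - y) < w (algebraMap K M a - y) := by
    by_contra! h
    obtain ⟨_, ⟨a, ha, rfl⟩, hmin⟩ := exists_min_valuation_eval w (IsAlgClosed.splits g)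
      (T := algebraMap K M '' A) ⟨_, 0, A.zero_mem, rfl⟩ (fun y hy => by
        obtain ⟨a, ha, hmin⟩ := h y hy
        refine ⟨_, ⟨a, ha, rfl⟩, ?_⟩
        rintro _ ⟨b, hb, rfl⟩
        exact hmin b hb)
    refine hext ⟨⟨a, ha⟩, fun b => (hle _ _).mpr ?_⟩
    have := hmin _ ⟨b, b.2, rfl⟩
    simpa [g, eval_map_algebraMap, aeval_algebraMap_apply, coe_aeval_eq_eval] using this
  obtain ⟨y, hy, hlt⟩ := hy
  have hysep : IsSeparable K y := hf.of_dvd <| minpoly.dvd K y <| by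
    rw [← eval_map_algebraMap]
    exact (mem_roots'.mp hy).2
  have hy1 : w y ≤ 1 := by
    by_contra! h
    obtain ⟨b, hb, hb'⟩ := hlt 0 A.zero_mem
    rw [w.map_sub_eq_of_lt_right (((hone b).mpr hb).trans_lt h)] at hb'
    simp at hb'
  have hlt' : ∀ a : K, ∃ b : K, w (algebraMap K M b - y) < w (algebraMap K M a - y) := by
    intro a
    by_cases ha : a ∈ A
    · obtain ⟨b, -, hb⟩ := hlt a ha
      exact ⟨b, hb⟩
    · have h1 : w y < w (algebraMap K M a) :=
        hy1.trans_lt (not_le.mp fun h => ha ((hone a).mp h))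
      refine ⟨0, ?_⟩
      rw [w.map_sub_eq_of_lt_left h1]
      simpa using h1
  obtain ⟨z, hzsep, hz, hmin⟩ := exists_isSeparable_minimal w hysep hlt'
  let L := IntermediateField.adjoin K {z}
  have : Algebra.IsSeparable K L :=
    (IntermediateField.isSeparable_adjoin_simple_iff_isSeparable K M).mpr hzsep
  obtain ⟨a, ha⟩ := hA L inferInstance inferInstance (B.comap (algebraMap L M))
    (by rw [ValuationSubring.comap_comap, ← IsScalarTower.algebraMap_eq, hB])
    (isImmediate_of_forall_exists_valuation_sub_lt fun x hx => by
      obtain ⟨c, hc⟩ := exists_valuation_sub_lt_of_minimal w hz hmin x.2 (by simpa using hx)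
      refine ⟨c, lt_of_not_ge fun h => ?_⟩
      rw [comap_valuation_le_iff] at h
      exact absurd hc (not_lt.mpr h))
    ⟨z, IntermediateField.mem_adjoin_simple_self K z⟩
  have haz : algebraMap K M a = z := congrArg (algebraMap L M) ha
  obtain ⟨b, hb⟩ := hlt' a
  exact absurd (hz b) (not_le.mpr (haz ▸ hb))

theorem separable_comp_linear {K : Type*} [Field K] {f : K[X]} (hf : f.Separable) (a : K) {c : K}
    (hc : c ≠ 0) : (f.comp (C a + C c * X)).Separable := by
  rw [separable_def, derivative_comp]
  have h : IsCoprime (f.comp (C a + C c * X)) ((derivative f).comp (C a + C c * X)) := by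
    simpa using IsCoprime.map hf (compRingHom (C a + C c * X))
  have : derivative (C a + C c * X) = C c := by simp
  rw [this]
  exact (isCoprime_mul_unit_left_right (isUnit_C.mpr hc.isUnit) _ _).mpr h

theorem isSepAlgMaximal_of_oExtremal {K : Type u} [Field K] {A : ValuationSubring K}
    (hA : ∀ f : K[X], f.Separable → OExtremal A f) : IsSepAlgMaximal A := by
  intro L _ _ _ hLsep B hB himm x
  by_contra hx
  let M := AlgebraicClosure L
  obtain ⟨D, hD⟩ := exists_valuationSubring_comap_eq (algebraMap L M) B
  set w := D.valuation
  set ξ := algebraMap L M x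
  have hleB : ∀ x y : L, B.valuation x ≤ B.valuation y ↔
      w (algebraMap L M x) ≤ w (algebraMap L M y) := by
    intro x y
    rw [← hD]
    exact comap_valuation_le_iff _ D x y
  have hle : ∀ x y : K, A.valuation x ≤ A.valuation y ↔
      w (algebraMap K M x) ≤ w (algebraMap K M y) := by
    intro x y
    rw [← hB, comap_valuation_le_iff, hleB]
    rfl
  have hmapK : ∀ a : K, algebraMap L M (algebraMap K L a) = algebraMap K M a := fun _ => rfl
  have hlt : ∀ a : K, ∃ b : K, w (algebraMap K M b - ξ) < w (algebraMap K M a - ξ) := by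
    intro a
    obtain ⟨b, hb⟩ := himm.exists_valuation_sub_lt_sub (x := x) hx a
    refine ⟨b, ?_⟩
    rw [← not_le, hleB, not_le] at hb
    simpa only [map_sub, hmapK] using hb
  set f := minpoly K x
  have hfsep : f.Separable := Algebra.IsSeparable.isSeparable K x
  set g := f.map (algebraMap K M)
  have hg : g.Splits := IsAlgClosed.splits g
  have hg0 : g ≠ 0 := (Polynomial.map_ne_zero_iff (algebraMap K M).injective).mpr hfsep.ne_zero
  have hξ : ξ ∈ g.roots := by
    rw [mem_roots hg0, IsRoot, eval_map_algebraMap, aeval_algebraMap_apply, minpoly.aeval,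
      map_zero]
  obtain ⟨a₀, ha₀⟩ := exists_forall_valuation_sub_le w hlt g.roots
  have hne : algebraMap K L a₀ - x ≠ 0 := fun h => hx ⟨a₀, sub_eq_zero.mp h⟩
  obtain ⟨c, hc⟩ := himm.1 _ hne
  have hc0 : c ≠ 0 := by
    rintro rfl
    rw [map_zero, map_zero] at hc
    exact hne ((B.valuation.zero_iff).mp hc)
  have hcw : w (algebraMap K M a₀ - ξ) = w (algebraMap K M c) := by
    have h1 := (hleB _ _).mp hc.le
    have h2 := (hleB _ _).mp hc.ge
    rw [map_sub, hmapK, hmapK] at h1 h2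
    exact le_antisymm h1 h2
  obtain ⟨t, ht⟩ := hA _ (separable_comp_linear hfsep a₀ hc0)
  set b := a₀ + c * t
  have hone : ∀ x : K, w (algebraMap K M x) ≤ 1 ↔ x ∈ A := by
    intro x
    rw [← A.valuation_le_one_iff]
    simpa using (hle x 1).symm
  have hb : w (algebraMap K M b - ξ) ≤ w (algebraMap K M a₀ - ξ) := by
    have e : algebraMap K M b - ξ =
        (algebraMap K M a₀ - ξ) + algebraMap K M c * algebraMap K M t := by
      simp only [b, map_add, map_mul]; ring
    rw [e]
    refine w.map_add_le le_rfl ?_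
    rw [map_mul, hcw]
    exact mul_le_of_le_one_right' ((hone _).mpr t.2)
  obtain ⟨b', hb'⟩ := hlt b
  have ht' : (b' - a₀) / c ∈ A := by
    rw [← hone, map_div₀, map_div₀]
    refine div_le_of_le_mul₀ zero_le zero_le ?_
    rw [one_mul, ← hcw]
    have e : algebraMap K M (b' - a₀) =
        (algebraMap K M b' - ξ) - (algebraMap K M a₀ - ξ) := by
      rw [map_sub]; ring
    rw [e]
    exact w.map_sub_le (hb'.le.trans hb) le_rfl
  have hmin := (hle _ _).mp (ht ⟨_, ht'⟩)
  have e' : a₀ + c * ((b' - a₀) / c) = b' := by field_simp; ring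
  simp only [eval_comp, eval_add, eval_C, eval_mul, eval_X, e'] at hmin
  have heval : ∀ s : K, algebraMap K M (f.eval s) = g.eval (algebraMap K M s) := by
    intro s
    rw [eval_map_algebraMap, aeval_algebraMap_apply, coe_aeval_eq_eval]
  rw [heval, heval, valuation_eval_eq w hg, valuation_eval_eq w hg] at hmin
  have hprod := multiset_prod_map_lt (fun y hy => (ha₀ b b' hb hb' y hy).1)
    (fun y hy => (ha₀ b b' hb hb' y hy).2) hξ hb'
  refine absurd hmin (not_le.mpr (mul_lt_mul_of_pos_left hprod ?_))
  simpa [zero_lt_iff] using hg0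

/-- A valued field is separable-algebraically maximal if and only if it is `O`-extremal with
respect to every separable polynomial in one variable with coefficients in `K`. -/
theorem statement4 {K : Type u} [Field K] (A : ValuationSubring K) :
    IsSepAlgMaximal A ↔ ∀ f : Polynomial K, f.Separable → OExtremal A f :=
  ⟨fun hA _ hf => hA.oExtremal hf, isSepAlgMaximal_of_oExtremal⟩

end ValuedDefect
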